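/- Let ν > 0, ω ∈ ℝ, m ≥ 1, and η = √ν/√(1+νω²). Let M and K be arbitrary m×m real matrices, 𝓜 = I₄ ⊗ M, 𝓚 = η · (I₄ ⊗ K), and G = (1/√(ν(1+νω²))) · (g ⊗ I_m), where g has rows (0, ων, √ν, 0), (−ων, 0, 0, √ν), (−√ν, 0, 0, −ων), (0, −√ν, ων, 0). Then for all real vectors x, b ∈ ℝ^{4m}: −𝓚·x + G·𝓜·x − G·b = −G·( b − (𝓜 + G·𝓚)·x ). -/

import Mathlib

open Matrix
open scoped Kronecker

/-- A `4 × 4` real matrix of this skew shape squares to a negative scalar matrix. -/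
theorem skew_fin_four_mul_self (a s : ℝ) :
    (!![0, a, s, 0; -a, 0, 0, s; -s, 0, 0, -a; 0, -s, a, 0] : Matrix (Fin 4) (Fin 4) ℝ) *
      !![0, a, s, 0; -a, 0, 0, s; -s, 0, 0, -a; 0, -s, a, 0] =
      (-(a ^ 2 + s ^ 2)) • (1 : Matrix (Fin 4) (Fin 4) ℝ) := by
  ext i j
  fin_cases i <;> fin_cases j <;> simp [Matrix.mul_apply, Fin.sum_univ_four] <;> ring

theorem stmt18 (ν ω : ℝ) (hν : 0 < ν) (m : ℕ) (hm : 1 ≤ m)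
    (η : ℝ) (hη : η = Real.sqrt ν / Real.sqrt (1 + ν * ω ^ 2))
    (M K : Matrix (Fin m) (Fin m) ℝ)
    (G 𝓜 𝓚 : Matrix (Fin 4 × Fin m) (Fin 4 × Fin m) ℝ)
    (hG : G = (1 / Real.sqrt (ν * (1 + ν * ω ^ 2))) •
      ((!![0, ω * ν, Real.sqrt ν, 0;
           -(ω * ν), 0, 0, Real.sqrt ν;
           -(Real.sqrt ν), 0, 0, -(ω * ν);
           0, -(Real.sqrt ν), ω * ν, 0] : Matrix (Fin 4) (Fin 4) ℝ) ⊗ₖ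
        (1 : Matrix (Fin m) (Fin m) ℝ)))
    (h𝓜 : 𝓜 = (1 : Matrix (Fin 4) (Fin 4) ℝ) ⊗ₖ M)
    (h𝓚 : 𝓚 = η • ((1 : Matrix (Fin 4) (Fin 4) ℝ) ⊗ₖ K)) :
    ∀ x b : Fin 4 × Fin m → ℝ,
      -(𝓚 *ᵥ x) + (G * 𝓜) *ᵥ x - G *ᵥ b = -(G *ᵥ (b - (𝓜 + G * 𝓚) *ᵥ x)) := by
  have hpos : 0 < ν * (1 + ν * ω ^ 2) := by positivity
  have hscale : 1 / √(ν * (1 + ν * ω ^ 2)) * (1 / √(ν * (1 + ν * ω ^ 2))) *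
      -((ω * ν) ^ 2 + √ν ^ 2) = -1 := by
    rw [div_mul_div_comm, Real.mul_self_sqrt hpos.le, Real.sq_sqrt hν.le]
    field_simp
    ring
  have hGG : G * G = -1 := by
    rw [hG, smul_mul_smul_comm, ← mul_kronecker_mul, skew_fin_four_mul_self, smul_kronecker,
      smul_smul, hscale, mul_one, one_kronecker_one, neg_one_smul]
  intro x b
  rw [mulVec_sub, mulVec_mulVec, Matrix.mul_add, ← Matrix.mul_assoc, hGG, add_mulVec,
    Matrix.neg_mul, Matrix.one_mul, neg_mulVec]
  abel
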